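/- Let S and A be measurable spaces, let p be a Markov kernel from S × A to S satisfying ‖p(s,a,·) − p(s′,a′,·)‖_TV ≤ 2α for all (s,a), (s′,a′) ∈ S × A with α ∈ (0,1), let φ : S → A be measurable, κ_φ(s) := p(s, φ(s)), and let r : S × A → ℝ be measurable with values in [0,1]. Fix a reference state s⋆ ∈ S. Then for every s ∈ S the series h^φ(s) := Σ_{t=0}^∞ ( ∫ r(x, φ(x)) dμ_t^{φ,s}(x) − ∫ r(x, φ(x)) dμ_t^{φ,s⋆}(x) ) converges absolutely (each summand has absolute value at most α^t), and span(h^φ) ≤ 1/(1−α), i.e. |h^φ(s₁) − h^φ(s₂)| ≤ 1/(1−α) for all s₁, s₂ ∈ S. -/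

import Mathlib

open MeasureTheory

/-- Total variation distance: `‖μ − ν‖_TV = 2 · sup {|μ(B) − ν(B)| : B measurable}`. -/
noncomputable def tvDist {S : Type*} [MeasurableSpace S] (μ ν : Measure S) : ℝ :=
  2 * ⨆ B : {B : Set S // MeasurableSet B}, |(μ B.1).toReal - (ν B.1).toReal|

/-- `stepIter κ t μ` is the `t`-step distribution, the `t`-fold iterate of
`μ ↦ bind μ κ` applied to `μ`. -/
noncomputable def stepIter {S : Type*} [MeasurableSpace S]
    (κ : S → Measure S) (t : ℕ) (μ : Measure S) : Measure S :=
  (fun m => m.bind κ)^[t] μ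

/-- If two probability measures differ by at most `α` on every measurable set, then their
integrals of a measurable function of oscillation at most `L` differ by at most `α * L`. -/
theorem abs_integral_sub_integral_le_of_oscillation {S : Type*} [MeasurableSpace S]
    {μ ν : Measure S} [IsProbabilityMeasure μ] [IsProbabilityMeasure ν] {α L : ℝ}
    (h : ∀ B, MeasurableSet B → |μ.real B - ν.real B| ≤ α)
    {f : S → ℝ} (hf : Measurable f) (hosc : ∀ x y, f x - f y ≤ L) :
    |∫ x, f x ∂μ - ∫ x, f x ∂ν| ≤ α * L := by
  obtain ⟨x₀⟩ := nonempty_of_isProbabilityMeasure μ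
  have : Nonempty S := ⟨x₀⟩
  have hL : 0 ≤ L := by simpa using hosc x₀ x₀
  have hbdd : BddBelow (Set.range f) :=
    ⟨f x₀ - L, by rintro _ ⟨y, rfl⟩; linarith [hosc x₀ y]⟩
  set a := ⨅ x, f x
  have h0 : ∀ x, 0 ≤ f x - a := fun x => sub_nonneg.2 (ciInf_le hbdd x)
  have h1 : ∀ x, f x - a ≤ L := fun x => by
    have : f x - L ≤ a := le_ciInf fun y => by linarith [hosc x y]
    linarith
  have hm : Measurable fun x => f x - a := hf.sub_const a
  have hint : ∀ m : Measure S, IsProbabilityMeasure m → Integrable (fun x => f x - a) m :=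
    fun m _ => Integrable.of_mem_Icc 0 L hm.aemeasurable
      (Filter.Eventually.of_forall fun x => ⟨h0 x, h1 x⟩)
  have hlayer : ∀ m : Measure S, IsProbabilityMeasure m →
      ∫ x, f x ∂m = (∫ t in Set.Ioc 0 L, m.real {x | t ≤ f x - a}) + a := fun m hprob => by
    rw [← (hint m hprob).integral_eq_integral_Ioc_meas_le (Filter.Eventually.of_forall h0)
      (Filter.Eventually.of_forall h1)]
    have hfi : Integrable f m := by
      simpa [Pi.add_def] using (hint m hprob).add (integrable_const a)
    rw [integral_sub hfi (integrable_const a)]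
    simp
  have htail : ∀ m : Measure S, IsProbabilityMeasure m →
      IntegrableOn (fun t => m.real {x | t ≤ f x - a}) (Set.Ioc 0 L) := fun m _ => by
    have hanti : Antitone fun t => m.real {x | t ≤ f x - a} :=
      fun s t hst => measureReal_mono fun x hx => hst.trans hx
    exact ((hanti.antitoneOn _).integrableOn_isCompact isCompact_Icc).mono_set
      Set.Ioc_subset_Icc_self
  rw [hlayer μ inferInstance, hlayer ν inferInstance, add_sub_add_right_eq_sub,
    ← integral_sub (htail μ inferInstance) (htail ν inferInstance)]
  have hbound := norm_setIntegral_le_of_norm_le_const (μ := volume) (s := Set.Ioc 0 L)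
    (f := fun t => μ.real {x | t ≤ f x - a} - ν.real {x | t ≤ f x - a}) (C := α)
    (by simp) (fun t _ => h _ (measurableSet_le measurable_const hm))
  simpa [Real.norm_eq_abs, hL] using hbound

theorem abs_measureReal_sub_le_one {S : Type*} [MeasurableSpace S] (μ ν : Measure S)
    [IsProbabilityMeasure μ] [IsProbabilityMeasure ν] (B : Set S) :
    |μ.real B - ν.real B| ≤ 1 := by
  rw [abs_le]
  constructor <;> linarith [measureReal_nonneg (μ := μ) (s := B),
    measureReal_nonneg (μ := ν) (s := B), measureReal_le_one (μ := μ) (s := B),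
    measureReal_le_one (μ := ν) (s := B)]

theorem abs_measureReal_sub_le_of_tvDist_le {S : Type*} [MeasurableSpace S] {μ ν : Measure S}
    [IsProbabilityMeasure μ] [IsProbabilityMeasure ν] {α : ℝ} (h : tvDist μ ν ≤ 2 * α)
    (B : Set S) (hB : MeasurableSet B) : |μ.real B - ν.real B| ≤ α := by
  have hbdd : BddAbove (Set.range fun B : {B : Set S // MeasurableSet B} =>
      |(μ B.1).toReal - (ν B.1).toReal|) :=
    ⟨1, by rintro _ ⟨B, rfl⟩; exact abs_measureReal_sub_le_one μ ν B.1⟩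
  have hle := le_ciSup hbdd ⟨B, hB⟩
  unfold tvDist at h
  change |μ.real B - ν.real B| ≤ _ at hle
  linarith

theorem isProbabilityMeasure_stepIter {S : Type*} [MeasurableSpace S] {κ : S → Measure S}
    (hκ : Measurable κ) (hprob : ∀ s, IsProbabilityMeasure (κ s)) (t : ℕ) (μ : Measure S)
    [IsProbabilityMeasure μ] : IsProbabilityMeasure (stepIter κ t μ) := by
  induction t with
  | zero => assumption
  | succ t ih =>
    rw [stepIter, Function.iterate_succ_apply']
    have : IsProbabilityMeasure ((fun m => m.bind κ)^[t] μ) := ih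
    exact isProbabilityMeasure_bind hκ.aemeasurable (Filter.Eventually.of_forall hprob)

/-- Geometric contraction of the iterates of a Doeblin kernel, tested against measurable
functions of bounded oscillation. -/
theorem abs_integral_stepIter_sub_le {S : Type*} [MeasurableSpace S] {κ : S → Measure S}
    (hκ : Measurable κ) (hprob : ∀ s, IsProbabilityMeasure (κ s)) {α : ℝ}
    (hDoeblin : ∀ s s', tvDist (κ s) (κ s') ≤ 2 * α) (μ ν : Measure S)
    [IsProbabilityMeasure μ] [IsProbabilityMeasure ν] (t : ℕ) {f : S → ℝ} {L : ℝ}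
    (hf : Measurable f) (hosc : ∀ x y, f x - f y ≤ L) :
    |∫ x, f x ∂(stepIter κ t μ) - ∫ x, f x ∂(stepIter κ t ν)| ≤ α ^ t * L := by
  induction t generalizing f L with
  | zero =>
    simpa [stepIter] using abs_integral_sub_integral_le_of_oscillation (α := 1)
      (fun B _ => abs_measureReal_sub_le_one μ ν B) hf hosc
  | succ t ih =>
    let K : ProbabilityTheory.Kernel S S := ⟨κ, hκ⟩
    have : ProbabilityTheory.IsMarkovKernel K := ⟨hprob⟩
    have hbind : ∀ m : Measure S, IsProbabilityMeasure m →
        ∫ x, f x ∂(stepIter κ (t + 1) m) = ∫ s, ∫ x, f x ∂(κ s) ∂(stepIter κ t m) := by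
      intro m _
      have := isProbabilityMeasure_stepIter hκ hprob t m
      obtain ⟨x₀⟩ := nonempty_of_isProbabilityMeasure m
      have hi : Integrable f ((stepIter κ t m).bind K) :=
        Integrable.of_mem_Icc (f x₀ - L) (f x₀ + L) hf.aemeasurable
          (Filter.Eventually.of_forall fun x =>
            ⟨by linarith [hosc x₀ x], by linarith [hosc x x₀]⟩)
      rw [stepIter, Function.iterate_succ_apply']
      change ∫ x, f x ∂((stepIter κ t m).bind K) = _
      rw [Measure.comp_eq_comp_const_apply] at hi ⊢
      rw [ProbabilityTheory.Kernel.integral_comp hi]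
      rfl
    rw [hbind μ inferInstance, hbind ν inferInstance, pow_succ, mul_assoc]
    refine ih (hf.stronglyMeasurable.integral_kernel (κ := K)).measurable fun x y => ?_
    have := hprob x
    have := hprob y
    exact (le_abs_self _).trans (abs_integral_sub_integral_le_of_oscillation
      (abs_measureReal_sub_le_of_tvDist_le (hDoeblin x y)) hf hosc)

/-- For a Doeblin kernel, a measurable policy `φ` and a `[0,1]`-valued
reward, the relative value function
`h^φ(s) = Σ_t (∫ r(·,φ(·)) dμ_t^{φ,s} − ∫ r(·,φ(·)) dμ_t^{φ,s⋆})` converges absolutely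
(each summand having absolute value at most `α^t`), and `span(h^φ) ≤ 1/(1−α)`. -/
theorem relative_value_function_span {S A : Type*}
    [MeasurableSpace S] [MeasurableSpace A]
    (p : S × A → Measure S) (hpm : Measurable p)
    (hpp : ∀ z, IsProbabilityMeasure (p z))
    (α : ℝ) (hα : α ∈ Set.Ioo (0 : ℝ) 1)
    (hDoeblin : ∀ z z' : S × A, tvDist (p z) (p z') ≤ 2 * α)
    (φ : S → A) (hφ : Measurable φ)
    (r : S × A → ℝ) (hrm : Measurable r) (hrb : ∀ z, r z ∈ Set.Icc (0 : ℝ) 1)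
    (sstar : S) :
    (∀ (s : S) (t : ℕ),
        |(∫ x, r (x, φ x) ∂(stepIter (fun s' => p (s', φ s')) t (Measure.dirac s))) -
            ∫ x, r (x, φ x) ∂(stepIter (fun s' => p (s', φ s')) t (Measure.dirac sstar))| ≤
          α ^ t) ∧
    (∀ s : S,
        Summable fun t : ℕ =>
          (∫ x, r (x, φ x) ∂(stepIter (fun s' => p (s', φ s')) t (Measure.dirac s))) -
            ∫ x, r (x, φ x) ∂(stepIter (fun s' => p (s', φ s')) t (Measure.dirac sstar))) ∧
    (∀ s₁ s₂ : S,
        |(∑' t : ℕ,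
            ((∫ x, r (x, φ x) ∂(stepIter (fun s' => p (s', φ s')) t (Measure.dirac s₁))) -
              ∫ x, r (x, φ x) ∂(stepIter (fun s' => p (s', φ s')) t (Measure.dirac sstar)))) -
          ∑' t : ℕ,
            ((∫ x, r (x, φ x) ∂(stepIter (fun s' => p (s', φ s')) t (Measure.dirac s₂))) -
              ∫ x, r (x, φ x) ∂(stepIter (fun s' => p (s', φ s')) t (Measure.dirac sstar)))| ≤
          1 / (1 - α)) := by
  have key : ∀ (s s' : S) (t : ℕ),
      |(∫ x, r (x, φ x) ∂(stepIter (fun s' => p (s', φ s')) t (Measure.dirac s))) -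
        ∫ x, r (x, φ x) ∂(stepIter (fun s' => p (s', φ s')) t (Measure.dirac s'))| ≤ α ^ t := by
    intro s s' t
    have hgraph : Measurable fun x : S => (x, φ x) := measurable_id.prodMk hφ
    have := abs_integral_stepIter_sub_le (κ := fun s' => p (s', φ s')) (hpm.comp hgraph)
      (fun _ => hpp _) (fun _ _ => hDoeblin _ _) (Measure.dirac s) (Measure.dirac s') t
      (f := fun x => r (x, φ x)) (L := 1) (hrm.comp hgraph)
      (fun x y => by linarith [(hrb (x, φ x)).2, (hrb (y, φ y)).1])
    simpa using this
  have hgeom := hasSum_geometric_of_lt_one hα.1.le hα.2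
  have hsum : ∀ s : S, Summable fun t : ℕ =>
      (∫ x, r (x, φ x) ∂(stepIter (fun s' => p (s', φ s')) t (Measure.dirac s))) -
        ∫ x, r (x, φ x) ∂(stepIter (fun s' => p (s', φ s')) t (Measure.dirac sstar)) :=
    fun s => Summable.of_norm_bounded hgeom.summable fun t => key s sstar t
  refine ⟨fun s t => key s sstar t, hsum, fun s₁ s₂ => ?_⟩
  rw [← (hsum s₁).tsum_sub (hsum s₂), one_div, ← Real.norm_eq_abs]
  refine tsum_of_norm_bounded hgeom fun t => ?_
  rw [sub_sub_sub_cancel_right]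
  exact key s₁ s₂ t
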